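/- Consider noiseless attacked measurements Y_i = O_i x₀ + e_i for i ∈ {1,…,p}, with attack support Γ₀ = {i : e_i ≠ 0} satisfying |Γ₀| ≤ s̄, and suppose the system is 2s̄-sparse observable. Then for every index set I ⊆ {1,…,p} with |I| ≥ p − s̄: there exists x ∈ ℝⁿ with O_i x = Y_i for all i ∈ I if and only if I ∩ Γ₀ = ∅; and when I ∩ Γ₀ = ∅, x = x₀ is the unique such solution. Consequently, in the noiseless exact-arithmetic case, Γ₀ is the unique minimum-cardinality set S with |S| ≤ s̄ such that the equations O_i x = Y_i, i ∈ Sᶜ, are solvable, and the corresponding solution recovers the true state x₀. -/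

import Mathlib

open Matrix

/-- Under sparse observability, a state consistent with at least `p - sb` measurements, of which
at most `sb` are attacked, is the true state. -/
theorem eq_state_of_consistent {n T p sb : ℕ}
    (O : Fin p → Matrix (Fin T) (Fin n) ℝ)
    (x₀ : Fin n → ℝ) (Y : Fin p → Fin T → ℝ) (Γ : Finset (Fin p))
    (hY : ∀ i ∉ Γ, Y i = (O i).mulVec x₀) (hcard : Γ.card ≤ sb)
    (hobs : ∀ I : Finset (Fin p), p - 2 * sb ≤ I.card →
      ∀ x x' : Fin n → ℝ, (∀ i ∈ I, (O i).mulVec x = (O i).mulVec x') → x = x')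
    (I : Finset (Fin p)) (hI : p - sb ≤ I.card)
    (x : Fin n → ℝ) (hx : ∀ i ∈ I, (O i).mulVec x = Y i) : x = x₀ := by
  refine hobs (I \ Γ) ?_ x x₀ fun i hi => ?_
  · have := Finset.le_card_sdiff Γ I
    omega
  · rw [Finset.mem_sdiff] at hi
    rw [hx i hi.1, hY i hi.2]

/-- Noiseless case: with Y_i = O_i x₀ + e_i, attack support Γ₀ with |Γ₀| ≤ s̄, and
2s̄-sparse observability, for every I with |I| ≥ p − s̄ the equations O_i x = Y_i,
i ∈ I, are solvable iff I ∩ Γ₀ = ∅, in which case x₀ is the unique solution.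
Consequently Γ₀ is the unique minimum-cardinality set S with |S| ≤ s̄ such that the
equations over Sᶜ are solvable, and the corresponding solution recovers x₀. -/
theorem noiseless_exact_recovery {n T p sb : ℕ} (hn : 0 < n) (hT : 0 < T) (hp : 0 < p)
    (O : Fin p → Matrix (Fin T) (Fin n) ℝ)
    (x₀ : Fin n → ℝ) (e : Fin p → Fin T → ℝ) (Y : Fin p → Fin T → ℝ)
    (hY : ∀ i, Y i = (O i).mulVec x₀ + e i)
    (Γ₀ : Finset (Fin p)) (hΓ₀ : Γ₀ = Finset.univ.filter (fun i => e i ≠ 0))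
    (hcard : Γ₀.card ≤ sb)
    (hobs : ∀ I : Finset (Fin p), p - 2 * sb ≤ I.card →
      ∀ x x' : Fin n → ℝ, (∀ i ∈ I, (O i).mulVec x = (O i).mulVec x') → x = x') :
    (∀ I : Finset (Fin p), p - sb ≤ I.card →
      ((∃ x : Fin n → ℝ, ∀ i ∈ I, (O i).mulVec x = Y i) ↔ I ∩ Γ₀ = ∅) ∧
      (I ∩ Γ₀ = ∅ →
        ∀ x : Fin n → ℝ, (∀ i ∈ I, (O i).mulVec x = Y i) → x = x₀)) ∧
    -- Γ₀ itself satisfies the constraints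
    (Γ₀.card ≤ sb ∧ ∃ x : Fin n → ℝ, ∀ i ∈ Γ₀ᶜ, (O i).mulVec x = Y i) ∧
    -- Γ₀ is the unique minimum-cardinality such set
    (∀ S : Finset (Fin p), S.card ≤ sb →
      (∃ x : Fin n → ℝ, ∀ i ∈ Sᶜ, (O i).mulVec x = Y i) →
      Γ₀.card ≤ S.card ∧ (S.card ≤ Γ₀.card → S = Γ₀)) ∧
    -- the corresponding solution recovers the true state
    (∀ x : Fin n → ℝ, (∀ i ∈ Γ₀ᶜ, (O i).mulVec x = Y i) → x = x₀) := by
  have mem_support : ∀ i, i ∈ Γ₀ ↔ e i ≠ 0 := by simp [hΓ₀]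
  have clean : ∀ i ∉ Γ₀, Y i = (O i).mulVec x₀ := fun i hi => by
    rw [hY, not_not.mp (mt (mem_support i).mpr hi), add_zero]
  have unique := eq_state_of_consistent O x₀ Y Γ₀ clean hcard hobs
  have card_compl_ge : ∀ S : Finset (Fin p), S.card ≤ sb → p - sb ≤ Sᶜ.card := fun S hS => by
    rw [Finset.card_compl, Fintype.card_fin]
    omega
  have not_attacked : ∀ I : Finset (Fin p), p - sb ≤ I.card →
      (∃ x : Fin n → ℝ, ∀ i ∈ I, (O i).mulVec x = Y i) → ∀ i ∈ I, i ∉ Γ₀ := by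
    rintro I hI ⟨x, hx⟩ i hi hmem
    have h := hx i hi
    rw [unique I hI x hx, hY i, left_eq_add] at h
    exact (mem_support i).mp hmem h
  refine ⟨fun I hI => ⟨⟨fun h => ?_, fun h => ⟨x₀, fun i hi => ?_⟩⟩, fun _ => unique I hI⟩,
    ⟨hcard, x₀, fun i hi => (clean i (Finset.mem_compl.mp hi)).symm⟩, fun S hS h => ?_,
    unique Γ₀ᶜ (card_compl_ge Γ₀ hcard)⟩
  · exact Finset.disjoint_iff_inter_eq_empty.mp
      (Finset.disjoint_left.mpr fun i hi => not_attacked I hI h i hi)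
  · exact (clean i (Finset.disjoint_left.mp (Finset.disjoint_iff_inter_eq_empty.mpr h) hi)).symm
  · have hsub : Γ₀ ⊆ S := fun i hi => by
      by_contra hS'
      exact not_attacked Sᶜ (card_compl_ge S hS) h i (Finset.mem_compl.mpr hS') hi
    exact ⟨Finset.card_le_card hsub, fun hle => (Finset.eq_of_subset_of_card_le hsub hle).symm⟩
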